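/- Lutwak's inequality for star-shaped bodies: let K ⊂ ℝⁿ be a compact set, star-shaped with respect to the origin (t·x ∈ K for all x ∈ K and t ∈ [0,1]) with 0 in its interior, whose barycenter is at the origin (∫_K x dx = 0). Then vol(K)·vol(K*) ≤ vol(B₂ⁿ)². -/

import Mathlib

open MeasureTheory Filter
open scoped InnerProductSpace Pointwise NNReal ENNReal Topology

noncomputable section

/-- The polar of a set `K` in Euclidean space: `{y | ⟨x,y⟩ ≤ 1 for all x ∈ K}`. -/
def polarSet {n : ℕ} (K : Set (EuclideanSpace ℝ (Fin n))) : Set (EuclideanSpace ℝ (Fin n)) :=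
  {y | ∀ x ∈ K, ⟪x, y⟫_ℝ ≤ 1}

theorem Real.volume_add_volume_le_of_isCompact {A B C : Set ℝ} (hA : IsCompact A) (hB : IsCompact B)
    (hA' : A.Nonempty) (hB' : B.Nonempty) (h : A + B ⊆ C) :
    volume A + volume B ≤ volume C := by
  obtain ⟨a, ha, hamax⟩ := hA.exists_isGreatest hA'
  obtain ⟨b, hb, hbmin⟩ := hB.exists_isLeast hB'
  have h1 : volume ((fun x => x + b) '' A) = volume A := by
    simp only [Set.image_add_right, measure_preimage_add_right]
  have h2 : volume ((fun x => a + x) '' B) = volume B := by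
    simp only [Set.image_add_left, measure_preimage_add]
  have hdisj : AEDisjoint volume ((fun x => x + b) '' A) ((fun x => a + x) '' B) := by
    refine measure_mono_null (t := {a + b}) ?_ (by simp)
    rintro _ ⟨⟨x, hx, rfl⟩, ⟨y, hy, hxy⟩⟩
    have := hamax hx
    have := hbmin hy
    simp only [Set.mem_singleton_iff] at *
    linarith
  rw [← h1, ← h2, ← measure_union₀ _ hdisj]
  · apply measure_mono
    rintro _ (⟨x, hx, rfl⟩ | ⟨x, hx, rfl⟩)
    · exact h (Set.add_mem_add hx hb)
    · exact h (Set.add_mem_add ha hx)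
  · exact (hB.image (by fun_prop)).measurableSet.nullMeasurableSet

/-- The one-dimensional Brunn–Minkowski inequality. -/
theorem Real.volume_add_volume_le {A B C : Set ℝ} (hA : MeasurableSet A) (hB : MeasurableSet B)
    (hA' : A.Nonempty) (hB' : B.Nonempty) (h : A + B ⊆ C) :
    volume A + volume B ≤ volume C := by
  have key : ∀ D : Set ℝ, MeasurableSet D → ∀ r < volume D,
      ∃ L ⊆ D, IsCompact L ∧ L.Nonempty ∧ r < volume L := by
    rintro D hD r hr
    obtain ⟨L, hLD, hL, hrL⟩ := hD.exists_lt_isCompact hr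
    exact ⟨L, hLD, hL, nonempty_of_measure_ne_zero (pos_of_gt hrL).ne', hrL⟩
  rcases eq_or_ne (volume A) 0 with hA0 | hA0
  · obtain ⟨a, ha⟩ := hA'
    rw [hA0, zero_add, ← measure_preimage_add volume (-a) B]
    apply measure_mono
    intro x hx
    have := h (Set.add_mem_add ha hx)
    simpa using this
  rcases eq_or_ne (volume B) 0 with hB0 | hB0
  · obtain ⟨b, hb⟩ := hB'
    rw [hB0, add_zero, ← measure_preimage_add_right volume (-b) A]
    apply measure_mono
    intro x hx
    have := h (Set.add_mem_add hx hb)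
    simpa using this
  by_contra! hlt
  obtain ⟨r, hr, s, hs, hrs⟩ := ENNReal.exists_lt_add_of_lt_add hlt hA0 hB0
  refine hrs.not_ge ?_
  obtain ⟨L, hLA, hL, hL', hrL⟩ := key A hA r hr
  obtain ⟨L₂, hLB, hL₂, hL₂', hrL₂⟩ := key B hB s hs
  exact (add_le_add hrL.le hrL₂.le).trans (Real.volume_add_volume_le_of_isCompact hL hL₂ hL' hL₂'
    ((Set.add_subset_add hLA hLB).trans h))

theorem lintegral_add_lintegral_le_of_mul_le_sq {φ ψ h : ℝ → ℝ} (hφ : Measurable φ)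
    (hψ : Measurable ψ) (hh : Measurable h) (hφ0 : ∀ x, 0 ≤ φ x) (hψ0 : ∀ x, 0 ≤ ψ x)
    (hh0 : ∀ x, 0 ≤ h x) (hφ1 : ∀ x, φ x ≤ 1) (hψ1 : ∀ x, ψ x ≤ 1)
    (hφs : ∀ t < 1, ∃ x, t < φ x) (hψs : ∀ t < 1, ∃ x, t < ψ x)
    (H : ∀ u v, φ u * ψ v ≤ h ((u + v) / 2) ^ 2) :
    (∫⁻ x, ENNReal.ofReal (φ x)) + ∫⁻ x, ENNReal.ofReal (ψ x) ≤
      2 * ∫⁻ x, ENNReal.ofReal (h x) := by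
  rw [lintegral_eq_lintegral_meas_lt _ (ae_of_all _ hφ0) hφ.aemeasurable,
    lintegral_eq_lintegral_meas_lt _ (ae_of_all _ hψ0) hψ.aemeasurable,
    lintegral_eq_lintegral_meas_lt _ (ae_of_all _ hh0) hh.aemeasurable,
    ← lintegral_add_left, ← lintegral_const_mul']
  · refine setLIntegral_mono' measurableSet_Ioi fun t (ht : 0 < t) => ?_
    rcases lt_or_ge t 1 with ht1 | ht1
    · have h2 : volume ((2 : ℝ) • {x | t < h x}) = 2 * volume {x | t < h x} := by
        rw [Measure.addHaar_smul]
        simp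
      rw [← h2]
      refine Real.volume_add_volume_le (measurableSet_lt measurable_const hφ)
        (measurableSet_lt measurable_const hψ) (hφs t ht1) (hψs t ht1) ?_
      rintro _ ⟨u, hu, v, hv, rfl⟩
      refine ⟨(u + v) / 2, ?_, by simp; ring⟩
      simp only [Set.mem_ofPred_eq] at *
      refine lt_of_pow_lt_pow_left₀ 2 (hh0 _) (lt_of_lt_of_le ?_ (H u v))
      nlinarith
    · have e1 : {x | t < φ x} = ∅ := Set.eq_empty_of_forall_notMem fun x hx =>
        absurd (hφ1 x) (not_le.2 (ht1.trans_lt hx))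
      have e2 : {x | t < ψ x} = ∅ := Set.eq_empty_of_forall_notMem fun x hx =>
        absurd (hψ1 x) (not_le.2 (ht1.trans_lt hx))
      simp [e1, e2]
  · simp
  · exact Antitone.measurable fun s t hst => measure_mono fun x hx => lt_of_le_of_lt hst hx

theorem ENNReal.four_mul_mul_le_add_sq (a b : ℝ≥0∞) : 4 * (a * b) ≤ (a + b) ^ 2 := by
  wlog hab : a ≤ b generalizing a b
  · rw [mul_comm a, add_comm]
    exact this b a (le_of_not_ge hab)
  obtain ⟨d, rfl⟩ := exists_add_of_le hab
  have : (a + (a + d)) ^ 2 = 4 * (a * (a + d)) + d ^ 2 := by ring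
  rw [this]
  exact le_self_add

/-- The one-dimensional multiplicative Prékopa–Leindler inequality for midpoints. -/
theorem lintegral_mul_lintegral_le_sq {φ ψ h : ℝ → ℝ≥0∞} {C : ℝ≥0∞} (hC : C ≠ ∞)
    (hφ : Measurable φ) (hψ : Measurable ψ) (hh : Measurable h) (hhC : ∀ x, h x ≤ C)
    (H : ∀ u v, φ u * ψ v ≤ h ((u + v) / 2) ^ 2) :
    (∫⁻ x, φ x) * ∫⁻ x, ψ x ≤ (∫⁻ x, h x) ^ 2 := by
  by_cases hφ0 : ∀ x, φ x = 0
  · simp [hφ0]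
  by_cases hψ0 : ∀ x, ψ x = 0
  · simp [hψ0]
  push Not at hφ0 hψ0
  obtain ⟨u₀, hu₀⟩ := hφ0
  obtain ⟨v₀, hv₀⟩ := hψ0
  set M := ⨆ x, φ x with hM
  set N := ⨆ x, ψ x with hN
  have hφM : ∀ x, φ x ≤ M := le_iSup φ
  have hψN : ∀ x, ψ x ≤ N := le_iSup ψ
  have hM0 : M ≠ 0 := (lt_of_lt_of_le (pos_iff_ne_zero.2 hu₀) (hφM u₀)).ne'
  have hN0 : N ≠ 0 := (lt_of_lt_of_le (pos_iff_ne_zero.2 hv₀) (hψN v₀)).ne'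
  have hMN : M * N ≤ C ^ 2 := by
    rw [hM, hN, ENNReal.iSup_mul]
    refine iSup_le fun u => ?_
    rw [ENNReal.mul_iSup]
    exact iSup_le fun v => (H u v).trans (by gcongr; exact hhC _)
  have hC2 : C ^ 2 < ∞ := by finiteness
  have hMt : M ≠ ∞ := fun h => by simp [h, hN0] at hMN; exact hC hMN
  have hNt : N ≠ ∞ := fun h => by simp [h, hM0] at hMN; exact hC hMN
  set c := (M * N) ^ (1 / 2 : ℝ) with hc
  have hc2 : c ^ 2 = M * N := by
    rw [hc, ← ENNReal.rpow_natCast, ← ENNReal.rpow_mul]; simp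
  have hc0 : c ≠ 0 := fun h => by simp [h, hM0, hN0] at hc2
  have hct : c ≠ ∞ := fun h => by
    rw [h] at hc2; exact ENNReal.mul_ne_top hMt hNt (by rw [← hc2]; simp)
  have hht : ∀ x, h x / c ≠ ∞ := fun x =>
    ENNReal.div_ne_top (ne_top_of_le_ne_top hC (hhC x)) hc0
  have hφt : ∀ x, φ x / M ≤ 1 := fun x => ENNReal.div_le_of_le_mul (by simpa using hφM x)
  have hψt : ∀ x, ψ x / N ≤ 1 := fun x => ENNReal.div_le_of_le_mul (by simpa using hψN x)
  have hφt' : ∀ x, φ x / M ≠ ∞ := fun x => ne_top_of_le_ne_top (by simp) (hφt x)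
  have hψt' : ∀ x, ψ x / N ≠ ∞ := fun x => ne_top_of_le_ne_top (by simp) (hψt x)
  have hs : ∀ (f : ℝ → ℝ≥0∞) (S : ℝ≥0∞), S = ⨆ x, f x → S ≠ 0 → S ≠ ∞ → (∀ x, f x / S ≠ ∞) →
      ∀ t < 1, ∃ x, t < (f x / S).toReal := by
    intro f S hS hS0 hSt hf t ht
    rcases lt_or_ge t 0 with ht0 | ht0
    · exact ⟨0, ht0.trans_le ENNReal.toReal_nonneg⟩
    have : ENNReal.ofReal t * S < ⨆ x, f x := by
      rw [← hS]
      calc _ < 1 * S := by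
            rw [ENNReal.mul_lt_mul_iff_left hS0 hSt]
            simpa using ht
        _ = S := one_mul S
    obtain ⟨x, hx⟩ := lt_iSup_iff.1 this
    refine ⟨x, ?_⟩
    rw [← ENNReal.ofReal_lt_iff_lt_toReal ht0 (hf x)]
    rwa [ENNReal.lt_div_iff_mul_lt (Or.inl hS0) (Or.inl hSt)]
  have key := lintegral_add_lintegral_le_of_mul_le_sq (φ := fun x => (φ x / M).toReal)
    (ψ := fun x => (ψ x / N).toReal) (h := fun x => (h x / c).toReal) (by fun_prop) (by fun_prop)
    (by fun_prop)
    (fun _ => ENNReal.toReal_nonneg) (fun _ => ENNReal.toReal_nonneg)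
    (fun _ => ENNReal.toReal_nonneg)
    (fun x => ENNReal.toReal_le_of_le_ofReal (by simp) (by simpa using hφt x))
    (fun x => ENNReal.toReal_le_of_le_ofReal (by simp) (by simpa using hψt x)) ?_ ?_ ?_
  · simp only [ENNReal.ofReal_toReal (hφt' _), ENNReal.ofReal_toReal (hψt' _),
      ENNReal.ofReal_toReal (hht _)] at key
    simp only [div_eq_mul_inv] at key
    rw [lintegral_mul_const _ hφ, lintegral_mul_const _ hψ, lintegral_mul_const _ hh] at key
    have h4 := (ENNReal.four_mul_mul_le_add_sq _ _).trans (pow_le_pow_left₀ (by simp) key 2)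
    have h5 : 4 * ((∫⁻ x, φ x) * (∫⁻ x, ψ x) * (M * N)⁻¹) ≤
        4 * ((∫⁻ x, h x) ^ 2 * (M * N)⁻¹) := by
      calc _ = 4 * ((∫⁻ x, φ x) * M⁻¹ * ((∫⁻ x, ψ x) * N⁻¹)) := by
            rw [ENNReal.mul_inv (Or.inl hM0) (Or.inl hMt)]; ring
        _ ≤ _ := h4
        _ = 4 * ((∫⁻ x, h x) ^ 2 * (c ^ 2)⁻¹) := by rw [ENNReal.inv_pow]; ring
        _ = _ := by rw [hc2]
    rwa [ENNReal.mul_le_mul_iff_right (by simp) (by simp),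
      ENNReal.mul_le_mul_iff_left (by simp; finiteness) (by simp [hM0, hN0])] at h5
  · exact hs φ M hM hM0 hMt hφt'
  · exact hs ψ N hN hN0 hNt hψt'
  · intro u v
    rw [← ENNReal.toReal_mul, ← ENNReal.toReal_pow]
    refine ENNReal.toReal_mono (by finiteness [hht ((u + v) / 2)]) ?_
    calc φ u / M * (ψ v / N) = φ u * ψ v * (M * N)⁻¹ := by
          rw [ENNReal.mul_inv (Or.inl hM0) (Or.inl hMt)]; simp only [div_eq_mul_inv]; ring
      _ ≤ h ((u + v) / 2) ^ 2 * (c ^ 2)⁻¹ := by rw [hc2]; gcongr; exact H u v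
      _ = _ := by rw [ENNReal.inv_pow, ← mul_pow, ← div_eq_mul_inv]

theorem lintegral_comp_exp_mul (φ : ℝ → ℝ≥0∞) :
    ∫⁻ u, φ (Real.exp u) * ENNReal.ofReal (Real.exp u) = ∫⁻ s in Set.Ioi 0, φ s := by
  have := lintegral_image_eq_lintegral_abs_deriv_mul (s := Set.univ) (f := Real.exp)
    (f' := Real.exp) MeasurableSet.univ (fun x _ => (Real.hasDerivAt_exp x).hasDerivWithinAt)
    Real.exp_injective.injOn φ
  rw [Set.image_univ, Real.range_exp] at this
  rw [this, setLIntegral_univ]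
  simp only [abs_of_pos (Real.exp_pos _), mul_comm]

theorem lintegral_exp_neg_sq_div_two_Ioi :
    (∫⁻ s in Set.Ioi (0 : ℝ), ENNReal.ofReal (Real.exp (-s ^ 2 / 2))) ^ 2 =
      ENNReal.ofReal (Real.pi / 2) := by
  have h : ∀ s : ℝ, -s ^ 2 / 2 = -(1 / 2) * s ^ 2 := fun s => by ring
  simp only [h]
  rw [← ofReal_integral_eq_lintegral_ofReal
    (integrable_exp_neg_mul_sq (by norm_num)).integrableOn
    (ae_of_all _ fun _ => (Real.exp_pos _).le), integral_gaussian_Ioi,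
    ← ENNReal.ofReal_pow (by positivity), div_pow, Real.sq_sqrt (by positivity)]
  congr 1
  ring

/-- A Prékopa–Leindler inequality in multiplicative form on the half-line. -/
theorem lintegral_Ioi_mul_lintegral_Ioi_le {φ ψ : ℝ → ℝ≥0∞} {k : ℝ≥0∞} (hk : k ≠ ∞)
    (hφ : Measurable φ) (hψ : Measurable ψ)
    (H : ∀ s > 0, ∀ t > 0, φ s * ψ t ≤ k * ENNReal.ofReal (Real.exp (-(s * t)))) :
    (∫⁻ s in Set.Ioi 0, φ s) * ∫⁻ t in Set.Ioi 0, ψ t ≤ k * ENNReal.ofReal (Real.pi / 2) := by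
  set r := k ^ (1 / 2 : ℝ) with hr
  have hr2 : r ^ 2 = k := by
    rw [hr, ← ENNReal.rpow_natCast, ← ENNReal.rpow_mul]; simp
  have hrt : r ≠ ∞ := fun h => hk (by rw [← hr2, h]; simp)
  have hbd : ∀ x : ℝ, Real.exp (-x ^ 2 / 2) * x ≤ 1 := fun x => by
    have h1 := Real.add_one_le_exp (x ^ 2 / 2)
    have h2 : x ≤ Real.exp (x ^ 2 / 2) := by nlinarith [sq_nonneg (x - 1)]
    calc Real.exp (-x ^ 2 / 2) * x ≤ Real.exp (-x ^ 2 / 2) * Real.exp (x ^ 2 / 2) := by gcongr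
      _ = 1 := by rw [← Real.exp_add]; ring_nf; simp
  rw [← lintegral_comp_exp_mul, ← lintegral_comp_exp_mul, ← lintegral_exp_neg_sq_div_two_Ioi,
    ← lintegral_comp_exp_mul, ← hr2, ← mul_pow, ← lintegral_const_mul' _ _ hrt]
  refine lintegral_mul_lintegral_le_sq hrt (by fun_prop) (by fun_prop) (by fun_prop) ?_ ?_
  · intro x
    rw [← ENNReal.ofReal_mul (by positivity)]
    calc _ ≤ r * 1 := by
          gcongr
          exact ENNReal.ofReal_le_one.2 (hbd _)
      _ = r := mul_one r
  · intro u v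
    have e1 : Real.exp ((u + v) / 2) ^ 2 = Real.exp u * Real.exp v := by
      rw [← Real.exp_nat_mul, ← Real.exp_add]; congr 1; push_cast; ring
    have e2 : Real.exp (-Real.exp ((u + v) / 2) ^ 2 / 2) ^ 2 =
        Real.exp (-(Real.exp u * Real.exp v)) := by
      rw [e1, ← Real.exp_nat_mul]; congr 1; push_cast; ring
    calc _ = φ (Real.exp u) * ψ (Real.exp v) *
          (ENNReal.ofReal (Real.exp u) * ENNReal.ofReal (Real.exp v)) := by ring
      _ ≤ k * ENNReal.ofReal (Real.exp (-(Real.exp u * Real.exp v))) *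
          (ENNReal.ofReal (Real.exp u) * ENNReal.ofReal (Real.exp v)) := by
        exact mul_le_mul' (H _ (Real.exp_pos u) _ (Real.exp_pos v)) le_rfl
      _ = _ := by
        rw [mul_pow, mul_pow, hr2, ← ENNReal.ofReal_pow (by positivity), e2,
          ← ENNReal.ofReal_pow (by positivity), e1, ENNReal.ofReal_mul (by positivity)]
        ring

/-- The functional Santaló inequality with constant `c` for the pairing `B`: if the measure with
density `f` is centered and `f x * g y ≤ exp (-B x y)`, then `(∫ f) (∫ g) ≤ c`. -/
def HasSantaloBound (E : Type*) [NormedAddCommGroup E] [NormedSpace ℝ E] [MeasureSpace E]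
    (B : LinearMap.BilinForm ℝ E) (c : ℝ≥0∞) : Prop :=
  ∀ f g : E → ℝ≥0∞, Measurable f → Measurable g →
    IsFiniteMeasure (volume.withDensity f) →
    Integrable (fun x : E => x) (volume.withDensity f) →
    ∫ x, x ∂(volume.withDensity f) = 0 →
    (∀ x y, f x * g y ≤ ENNReal.ofReal (Real.exp (-B x y))) →
    (∫⁻ x, f x) * ∫⁻ y, g y ≤ c

/-- The pairing `s * t + B x y` on `ℝ × E`. -/
def prodPairing {E : Type*} [AddCommGroup E] [Module ℝ E] (B : LinearMap.BilinForm ℝ E) :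
    LinearMap.BilinForm ℝ (ℝ × E) :=
  LinearMap.mk₂ ℝ (fun p q => p.1 * q.1 + B p.2 q.2)
    (fun _ _ _ => by simp; ring) (fun _ _ _ => by simp; ring)
    (fun _ _ _ => by simp; ring) (fun _ _ _ => by simp; ring)

theorem prodPairing_apply {E : Type*} [AddCommGroup E] [Module ℝ E]
    (B : LinearMap.BilinForm ℝ E) (p q : ℝ × E) :
    prodPairing B p q = p.1 * q.1 + B p.2 q.2 := rfl

theorem HasSantaloBound.mul_le {E : Type*} [NormedAddCommGroup E] [NormedSpace ℝ E]
    [MeasureSpace E] {B : LinearMap.BilinForm ℝ E} {c : ℝ≥0∞} (hE : HasSantaloBound E B c)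
    {k : ℝ≥0∞} (hk : k ≠ ∞) (hk0 : k ≠ 0) {f g : E → ℝ≥0∞} (hf : Measurable f) (hg : Measurable g)
    (hfin : IsFiniteMeasure (volume.withDensity f))
    (hfi : Integrable (fun x : E => x) (volume.withDensity f))
    (hcent : ∫ x, x ∂(volume.withDensity f) = 0)
    (H : ∀ x y, f x * g y ≤ k * ENNReal.ofReal (Real.exp (-B x y))) :
    (∫⁻ x, f x) * ∫⁻ y, g y ≤ k * c := by
  have := hE f (fun y => k⁻¹ * g y) hf (by fun_prop) hfin hfi hcent fun x y => by
    calc f x * (k⁻¹ * g y) = k⁻¹ * (f x * g y) := by ring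
      _ ≤ k⁻¹ * (k * ENNReal.ofReal (Real.exp (-B x y))) := mul_le_mul' le_rfl (H x y)
      _ = _ := by rw [← mul_assoc, ENNReal.inv_mul_cancel hk0 hk, one_mul]
  rw [lintegral_const_mul _ hg] at this
  calc (∫⁻ x, f x) * ∫⁻ y, g y = k * ((∫⁻ x, f x) * (k⁻¹ * ∫⁻ y, g y)) := by
        rw [mul_left_comm _ k⁻¹, ← mul_assoc k, ENNReal.mul_inv_cancel hk0 hk, one_mul]
    _ ≤ _ := by gcongr

theorem lintegral_Ioi_comp_mul_of_sign {ε : ℝ} (hε : ε = 1 ∨ ε = -1) (φ : ℝ → ℝ≥0∞) :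
    ∫⁻ t in Set.Ioi 0, φ (ε * t) = ∫⁻ t in {t | 0 < ε * t}, φ t := by
  rcases hε with rfl | rfl
  · simp [Set.Ioi]
  · have h := (Measure.measurePreserving_neg (volume : Measure ℝ)).setLIntegral_comp_preimage_emb
      (MeasurableEquiv.neg ℝ).measurableEmbedding φ (Set.Iio 0)
    have e : {t : ℝ | 0 < -1 * t} = Set.Iio 0 := by ext; simp
    rw [e, ← h]
    simp

theorem lintegral_lintegral_comp_shear {E : Type*} [NormedAddCommGroup E] [NormedSpace ℝ E]
    [MeasureSpace E] [BorelSpace E] [SecondCountableTopology E]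
    [SFinite (volume : Measure E)] [(volume : Measure E).IsAddLeftInvariant]
    {ε : ℝ} (hε : ε = 1 ∨ ε = -1) (a : ℝ) (q w : E) {k : ℝ × E → ℝ≥0∞} (hk : Measurable k) :
    ∫⁻ y, ∫⁻ t in Set.Ioi (0 : ℝ), k (a + ε * t, q + (ε * t) • w + y) =
      ∫⁻ p in {p : ℝ × E | 0 < ε * (p.1 - a)}, k p := by
  have hS : MeasurableSet {p : ℝ × E | 0 < ε * (p.1 - a)} :=
    measurableSet_lt measurable_const (by fun_prop)
  rw [lintegral_lintegral_swap (by fun_prop)]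
  have htrans : ∀ t, ∫⁻ y, k (a + ε * t, q + (ε * t) • w + y) = ∫⁻ y, k (a + ε * t, y) :=
    fun t => lintegral_add_left_eq_self (fun y => k (a + ε * t, y)) _
  simp only [htrans]
  rw [lintegral_Ioi_comp_mul_of_sign hε (fun t => ∫⁻ y, k (a + t, y)),
    ← lintegral_indicator (measurableSet_lt measurable_const (by fun_prop)),
    ← lintegral_indicator hS, Measure.volume_eq_prod,
    lintegral_prod _ (hk.indicator hS).aemeasurable]
  refine Eq.trans ?_ (lintegral_add_left_eq_self _ a)
  refine lintegral_congr fun t => ?_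
  by_cases ht : 0 < ε * t <;> simp [Set.indicator, ht]

theorem lintegral_Ioi_add_lintegral_Ioi_neg (φ : ℝ → ℝ≥0∞) (b : ℝ) :
    (∫⁻ s in Set.Ioi (0 : ℝ), φ (1 * s - b)) + ∫⁻ s in Set.Ioi (0 : ℝ), φ (-1 * s - b) =
      ∫⁻ s, φ s := by
  rw [lintegral_Ioi_comp_mul_of_sign (Or.inl rfl) (fun s => φ (s - b)),
    lintegral_Ioi_comp_mul_of_sign (Or.inr rfl) (fun s => φ (s - b))]
  have e1 : {t : ℝ | 0 < 1 * t} = Set.Ioi 0 := by ext; simp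
  have e2 : {t : ℝ | 0 < -1 * t} = Set.Iio 0 := by ext; simp
  rw [e1, e2, add_comm, Measure.restrict_congr_set Iio_ae_eq_Iic, ← Set.compl_Iic,
    lintegral_add_compl _ measurableSet_Iic, lintegral_sub_right_eq_self]

theorem exists_measureReal_Iic_eq_half (ρ : Measure ℝ) [IsFiniteMeasure ρ] [NullSingletonClass ρ]
    (hρ : ρ ≠ 0) : ∃ a, ρ.real (Set.Iic a) = ρ.real Set.univ / 2 := by
  have hpos : 0 < ρ.real Set.univ := by
    simpa [Measure.real, ENNReal.toReal_pos_iff, pos_iff_ne_zero] using hρ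
  have hcont : Continuous fun b => ρ.real (Set.Iic b) := by
    have h := intervalIntegral.continuous_primitive (μ := ρ) (f := fun _ => (1 : ℝ))
      (fun a b => intervalIntegrable_const) 0
    have e : (fun b => ρ.real (Set.Iic b)) =
        fun b => (∫ _ in (0 : ℝ)..b, (1 : ℝ) ∂ρ) + ρ.real (Set.Iic 0) := by
      ext b
      rw [← intervalIntegral.integral_Iic_sub_Iic (integrable_const _).integrableOn
        (integrable_const _).integrableOn]
      simp
    rw [e]
    exact h.add continuous_const
  have htop : Tendsto (fun b => ρ.real (Set.Iic b)) atTop (𝓝 (ρ.real Set.univ)) :=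
    (ENNReal.tendsto_toReal (by finiteness)).comp (tendsto_measure_Iic_atTop ρ)
  have hbot : Tendsto (fun b => ρ.real (Set.Iic b)) atBot (𝓝 0) := by
    have := tendsto_measure_iInter_atBot (μ := ρ) (s := fun b : ℝ => Set.Iic b)
      (fun _ => measurableSet_Iic.nullMeasurableSet) (fun _ _ h => Set.Iic_subset_Iic.2 h)
      ⟨0, by finiteness⟩
    have hempty : ⋂ b : ℝ, Set.Iic b = ∅ := Set.eq_empty_of_forall_notMem fun x hx => by
      have := Set.mem_iInter.1 hx (x - 1)
      simp only [Set.mem_Iic] at this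
      linarith
    rw [hempty, measure_empty] at this
    exact (ENNReal.tendsto_toReal ENNReal.zero_ne_top).comp this
  obtain ⟨a, ha⟩ := mem_range_of_exists_le_of_exists_ge hcont
    (hbot.eventually_le_const (half_pos hpos)).exists
    (htop.eventually_const_le (half_lt_self hpos)).exists
  exact ⟨a, ha⟩

/-- Two vectors `q`, `w` for which the affine line `s ↦ q + s • w` passes through two prescribed
weighted points at heights of opposite sign. -/
theorem exists_line_through {E : Type*} [AddCommGroup E] [Module ℝ E] {m σ τ : ℝ}
    (hm : 0 < m) (hσ : 0 < σ) (hτ : τ < 0) (Y Z : E) :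
    ∃ q w : E, Y - m • q - σ • w = 0 ∧ Z - m • q - τ • w = 0 := by
  have hd : σ - τ ≠ 0 := by linarith
  refine ⟨m⁻¹ • (Y - σ • ((σ - τ)⁻¹ • (Y - Z))), (σ - τ)⁻¹ • (Y - Z), ?_, ?_⟩
  · rw [smul_inv_smul₀ hm.ne']
    abel
  · rw [smul_inv_smul₀ hm.ne']
    have : Z - (Y - σ • (σ - τ)⁻¹ • (Y - Z)) - τ • (σ - τ)⁻¹ • (Y - Z) =
        ((σ - τ) * (σ - τ)⁻¹ - 1) • (Y - Z) := by module
    rw [this, mul_inv_cancel₀ hd, sub_self, zero_smul]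

theorem lintegral_half_add_lintegral_half {E : Type*} [MeasureSpace E]
    [SFinite (volume : Measure E)] {h : ℝ × E → ℝ≥0∞} (hh : Measurable h) {b : E → ℝ}
    (hb : Measurable b) :
    (∫⁻ x, ∫⁻ s in Set.Ioi (0 : ℝ), h (1 * s - b x, x)) +
      ∫⁻ x, ∫⁻ s in Set.Ioi (0 : ℝ), h (-1 * s - b x, x) = ∫⁻ p, h p := by
  rw [← lintegral_add_left (Measurable.lintegral_prod_right (by fun_prop)),
    Measure.volume_eq_prod, lintegral_prod_symm _ (by fun_prop)]
  exact lintegral_congr fun x => lintegral_Ioi_add_lintegral_Ioi_neg (fun s => h (s, x)) (b x)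

theorem exists_center {E : Type*} [NormedAddCommGroup E] [NormedSpace ℝ E]
    [FiniteDimensional ℝ E] [MeasureSpace E] [(volume : Measure E).IsAddHaarMeasure]
    (ν : Measure (ℝ × E)) [IsFiniteMeasure ν] (hν : ν ≠ 0)
    (hfi : Integrable (fun p : ℝ × E => p) ν) (hac : ν ≪ volume) :
    ∃ (a : ℝ) (q w : E), ∀ ε : ℝ, ε = 1 ∨ ε = -1 →
      ν {p | 0 < ε * (p.1 - a)} = ν Set.univ / 2 ∧
      ∫ p in {p | 0 < ε * (p.1 - a)}, (p.2 - q - (p.1 - a) • w) ∂ν = 0 := by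
  set ρ := ν.map Prod.fst with hρ
  have hnull : ∀ s : ℝ, ν (Prod.fst ⁻¹' {s}) = 0 := fun s => hac <| by
    rw [← Set.prod_univ, Measure.volume_eq_prod, Measure.prod_prod]
    simp
  have : NullSingletonClass ρ := ⟨fun s => by
    rw [hρ, Measure.map_apply measurable_fst (measurableSet_singleton s)]
    exact hnull s⟩
  have hρ0 : ρ ≠ 0 := by
    rwa [hρ, Ne, Measure.map_eq_zero_iff measurable_fst.aemeasurable]
  obtain ⟨a, ha⟩ := exists_measureReal_Iic_eq_half ρ hρ0
  have huniv : ρ.real Set.univ = ν.real Set.univ := by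
    rw [hρ, map_measureReal_apply measurable_fst MeasurableSet.univ, Set.preimage_univ]
  have hm : 0 < ν.real Set.univ := by
    simpa [Measure.real, ENNReal.toReal_pos_iff, pos_iff_ne_zero] using hν
  have hSp : {p : ℝ × E | 0 < 1 * (p.1 - a)} = Prod.fst ⁻¹' Set.Ioi a := by ext; simp
  have hSn : {p : ℝ × E | 0 < -1 * (p.1 - a)} = Prod.fst ⁻¹' Set.Iio a := by ext; simp
  have hmn : ν.real (Prod.fst ⁻¹' Set.Iio a) = ν.real Set.univ / 2 := by
    rw [← map_measureReal_apply measurable_fst measurableSet_Iio, ← hρ, ← huniv, ← ha]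
    exact measureReal_congr Iio_ae_eq_Iic
  have hmp : ν.real (Prod.fst ⁻¹' Set.Ioi a) = ν.real Set.univ / 2 := by
    rw [← map_measureReal_apply measurable_fst measurableSet_Ioi, ← hρ, ← Set.compl_Iic,
      measureReal_compl measurableSet_Iic, ha, huniv]
    ring
  have hconv : ∀ S : Set (ℝ × E), ν.real S = ν.real Set.univ / 2 → ν S = ν Set.univ / 2 := by
    intro S hS
    rw [← ENNReal.toReal_eq_toReal_iff' (by finiteness) (by finiteness)]
    simpa [Measure.real] using hS
  have h1 : Integrable (fun p : ℝ × E => p.1 - a) ν := hfi.fst.sub (integrable_const a)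
  have h2 : Integrable (fun p : ℝ × E => p.2) ν := hfi.snd
  have hsplit : ∀ (q w : E) (S : Set (ℝ × E)), ν.real S = ν.real Set.univ / 2 →
      ∫ p in S, (p.2 - q - (p.1 - a) • w) ∂ν =
        (∫ p in S, p.2 ∂ν) - (ν.real Set.univ / 2) • q - (∫ p in S, (p.1 - a) ∂ν) • w := by
    intro q w S hS
    have h3 : Integrable (fun p : ℝ × E => p.2 - q) ν := h2.sub (integrable_const q)
    rw [integral_sub h3.restrict (h1.restrict.smul_const w),
      integral_sub h2.restrict (integrable_const q), setIntegral_const, hS,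
      integral_smul_const]
  have hσ : 0 < ∫ p in Prod.fst ⁻¹' Set.Ioi a, (p.1 - a) ∂ν := by
    rw [setIntegral_pos_iff_support_of_nonneg_ae _ h1.integrableOn]
    · have : Function.support (fun p : ℝ × E => p.1 - a) ∩ Prod.fst ⁻¹' Set.Ioi a =
          Prod.fst ⁻¹' Set.Ioi a :=
        Set.inter_eq_right.2 fun p (hp : a < p.1) => (sub_pos.2 hp).ne'
      rw [this, hconv _ hmp]
      simpa [pos_iff_ne_zero] using hν
    · exact (ae_restrict_iff' (measurable_fst measurableSet_Ioi)).2
        (ae_of_all _ fun p (hp : a < p.1) => (sub_pos.2 hp).le)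
  have hτ : ∫ p in Prod.fst ⁻¹' Set.Iio a, (p.1 - a) ∂ν < 0 := by
    have h1' : Integrable (fun p : ℝ × E => -(p.1 - a)) ν := h1.neg
    rw [← neg_pos, ← integral_neg, setIntegral_pos_iff_support_of_nonneg_ae _ h1'.integrableOn]
    · have : Function.support (fun p : ℝ × E => -(p.1 - a)) ∩ Prod.fst ⁻¹' Set.Iio a =
          Prod.fst ⁻¹' Set.Iio a :=
        Set.inter_eq_right.2 fun p (hp : p.1 < a) => (neg_pos.2 (sub_neg.2 hp)).ne'
      rw [this, hconv _ hmn]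
      simpa [pos_iff_ne_zero] using hν
    · exact (ae_restrict_iff' (measurable_fst measurableSet_Iio)).2
        (ae_of_all _ fun p (hp : p.1 < a) => (neg_pos.2 (sub_neg.2 hp)).le)
  obtain ⟨q, w, hq1, hq2⟩ := exists_line_through (half_pos hm) hσ hτ
    (∫ p in Prod.fst ⁻¹' Set.Ioi a, p.2 ∂ν) (∫ p in Prod.fst ⁻¹' Set.Iio a, p.2 ∂ν)
  refine ⟨a, q, w, ?_⟩
  rintro ε (rfl | rfl)
  · rw [hSp]
    exact ⟨hconv _ hmp, (hsplit q w _ hmp).trans hq1⟩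
  · rw [hSn]
    exact ⟨hconv _ hmn, (hsplit q w _ hmn).trans hq2⟩

section

variable {E : Type*} [NormedAddCommGroup E] [NormedSpace ℝ E] [FiniteDimensional ℝ E]
  [MeasureSpace E] [BorelSpace E] [(volume : Measure E).IsAddHaarMeasure]

theorem withDensity_shear {ε : ℝ} (hε : ε = 1 ∨ ε = -1) (a : ℝ) (q w : E) {g : ℝ × E → ℝ≥0∞}
    (hg : Measurable g) :
    volume.withDensity
        (fun y => ∫⁻ t in Set.Ioi (0 : ℝ), g (a + ε * t, q + (ε * t) • w + y)) =
      ((volume.withDensity g).restrict {p | 0 < ε * (p.1 - a)}).map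
        (fun p => p.2 - q - (p.1 - a) • w) := by
  have hS : MeasurableSet {p : ℝ × E | 0 < ε * (p.1 - a)} :=
    measurableSet_lt measurable_const (by fun_prop)
  have hP : Measurable fun p : ℝ × E => p.2 - q - (p.1 - a) • w := by fun_prop
  ext A hA
  rw [withDensity_apply _ hA, Measure.map_apply hP hA, Measure.restrict_apply (hP hA),
    withDensity_apply _ ((hP hA).inter hS), ← Measure.restrict_restrict (hP hA),
    ← lintegral_indicator (hP hA), ← lintegral_lintegral_comp_shear hε a q w
      (hg.indicator (hP hA)), ← lintegral_indicator hA]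
  refine lintegral_congr fun y => ?_
  have hmem : ∀ t : ℝ, (a + ε * t, q + (ε * t) • w + y) ∈
      (fun p : ℝ × E => p.2 - q - (p.1 - a) • w) ⁻¹' A ↔ y ∈ A := fun t => by
    rw [Set.mem_preimage]
    congr! 1
    simp only [add_sub_cancel_left]
    abel
  by_cases hy : y ∈ A <;> simp [Set.indicator, hmem, hy]

theorem HasSantaloBound.half {B : LinearMap.BilinForm ℝ E} {c : ℝ≥0∞} (hE : HasSantaloBound E B c)
    {ε : ℝ} (hε : ε = 1 ∨ ε = -1) (a : ℝ) (q w : E) {g h : ℝ × E → ℝ≥0∞}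
    (hg : Measurable g) (hh : Measurable h) (hfin : IsFiniteMeasure (volume.withDensity g))
    (hfi : Integrable (fun p : ℝ × E => p) (volume.withDensity g))
    (hcent : ∫ p in {p | 0 < ε * (p.1 - a)}, (p.2 - q - (p.1 - a) • w) ∂(volume.withDensity g) = 0)
    (H : ∀ p r, g ((a, q) + p) * h r ≤ ENNReal.ofReal (Real.exp (-prodPairing B p r))) :
    volume.withDensity g {p | 0 < ε * (p.1 - a)} *
      (∫⁻ x, ∫⁻ s in Set.Ioi (0 : ℝ), h (ε * s - B w x, x)) ≤ ENNReal.ofReal (Real.pi / 2) * c := by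
  have hS : MeasurableSet {p : ℝ × E | 0 < ε * (p.1 - a)} :=
    measurableSet_lt measurable_const (by fun_prop)
  have hP : Measurable fun p : ℝ × E => p.2 - q - (p.1 - a) • w := by fun_prop
  have hBm : Measurable fun x => B w x :=
    (LinearMap.continuous_of_finiteDimensional (B w)).measurable
  have hG := withDensity_shear hε a q w hg
  have key := hE.mul_le (k := ENNReal.ofReal (Real.pi / 2)) (by simp)
    (by simpa using Real.pi_pos)
    (f := fun y => ∫⁻ t in Set.Ioi (0 : ℝ), g (a + ε * t, q + (ε * t) • w + y))
    (g := fun x => ∫⁻ s in Set.Ioi (0 : ℝ), h (ε * s - B w x, x)) 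
    (Measurable.lintegral_prod_right (by fun_prop)) (Measurable.lintegral_prod_right (by fun_prop))
    ?_ ?_ ?_ ?_
  · rwa [lintegral_lintegral_comp_shear hε a q w hg, ← withDensity_apply _ hS] at key
  · rw [hG]
    exact Measure.isFiniteMeasure_map _ _
  · rw [hG, integrable_map_measure (by fun_prop) hP.aemeasurable]
    have h1 := hfi.fst
    have h2 := hfi.snd
    exact ((h2.sub (integrable_const q)).sub ((h1.sub (integrable_const a)).smul_const w)).restrict
  · rw [hG, integral_map hP.aemeasurable (by fun_prop)]
    exact hcent
  · intro y x
    rw [mul_comm (ENNReal.ofReal _)]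
    refine lintegral_Ioi_mul_lintegral_Ioi_le ENNReal.ofReal_ne_top (by fun_prop) (by fun_prop) ?_
    intro t ht s hs
    have hε2 : ε * ε = 1 := by rcases hε with rfl | rfl <;> norm_num
    have hts : prodPairing B (ε * t, (ε * t) • w + y) (ε * s - B w x, x) = B y x + t * s := by
      simp only [prodPairing_apply, map_add, map_smul, LinearMap.add_apply, LinearMap.smul_apply,
        smul_eq_mul]
      linear_combination t * s * hε2
    have := H (ε * t, (ε * t) • w + y) (ε * s - B w x, x)
    rw [hts, neg_add, Real.exp_add, ENNReal.ofReal_mul (Real.exp_pos _).le] at this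
    simpa [add_assoc] using this

theorem HasSantaloBound.exists_translate {B : LinearMap.BilinForm ℝ E} {c : ℝ≥0∞}
    (hE : HasSantaloBound E B c) {g : ℝ × E → ℝ≥0∞} (hg : Measurable g)
    (hfin : IsFiniteMeasure (volume.withDensity g))
    (hfi : Integrable (fun p : ℝ × E => p) (volume.withDensity g)) :
    ∃ z, ∀ h : ℝ × E → ℝ≥0∞, Measurable h →
      (∀ p r, g (z + p) * h r ≤ ENNReal.ofReal (Real.exp (-prodPairing B p r))) →
      (∫⁻ p, g p) * ∫⁻ r, h r ≤ ENNReal.ofReal (2 * Real.pi) * c := by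
  have htot : volume.withDensity g Set.univ = ∫⁻ p, g p := by
    rw [withDensity_apply _ MeasurableSet.univ, Measure.restrict_univ]
  by_cases h0 : volume.withDensity g = 0
  · refine ⟨0, fun h _ _ => ?_⟩
    rw [← htot, h0]
    simp
  obtain ⟨a, q, w, H⟩ := exists_center _ h0 hfi (withDensity_absolutelyContinuous _ _)
  refine ⟨(a, q), fun h hh hgh => ?_⟩
  have key : ∀ ε : ℝ, ε = 1 ∨ ε = -1 → (∫⁻ p, g p) / 2 *
      (∫⁻ x, ∫⁻ s in Set.Ioi (0 : ℝ), h (ε * s - B w x, x)) ≤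
        ENNReal.ofReal (Real.pi / 2) * c := fun ε hε => by
    rw [← htot, ← (H ε hε).1]
    exact hE.half hε a q w hg hh hfin hfi (H ε hε).2 hgh
  have hBm : Measurable fun x => B w x :=
    (LinearMap.continuous_of_finiteDimensional (B w)).measurable
  have h2 : ENNReal.ofReal (2 * Real.pi) = 2 * (2 * ENNReal.ofReal (Real.pi / 2)) := by
    have : 2 * Real.pi = 2 * (2 * (Real.pi / 2)) := by ring
    rw [this, ENNReal.ofReal_mul zero_le_two, ENNReal.ofReal_mul zero_le_two]
    simp
  calc (∫⁻ p, g p) * ∫⁻ r, h r = 2 * ((∫⁻ p, g p) / 2) * ∫⁻ r, h r := by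
        rw [ENNReal.mul_div_cancel two_ne_zero ENNReal.ofNat_ne_top]
    _ = 2 * ((∫⁻ p, g p) / 2 * (∫⁻ x, ∫⁻ s in Set.Ioi (0 : ℝ), h (1 * s - B w x, x)) +
        (∫⁻ p, g p) / 2 * (∫⁻ x, ∫⁻ s in Set.Ioi (0 : ℝ), h (-1 * s - B w x, x))) := by
        rw [← mul_add, lintegral_half_add_lintegral_half hh hBm, mul_assoc]
    _ ≤ 2 * (ENNReal.ofReal (Real.pi / 2) * c + ENNReal.ofReal (Real.pi / 2) * c) := by
        gcongr 2 * (?_ + ?_)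
        exacts [key 1 (Or.inl rfl), key (-1) (Or.inr rfl)]
    _ = _ := by rw [h2]; ring

theorem measure_univ_le_lintegral_exp {F : Type*} [NormedAddCommGroup F] [NormedSpace ℝ F]
    [CompleteSpace F] [MeasurableSpace F] [BorelSpace F] {μ : Measure F} [IsFiniteMeasure μ]
    (hfi : Integrable (fun x : F => x) μ) (hcent : ∫ x, x ∂μ = 0) (l : F →L[ℝ] ℝ) :
    μ Set.univ ≤ ∫⁻ x, ENNReal.ofReal (Real.exp (l x)) ∂μ := by
  have hl : Integrable (fun x => l x) μ := l.integrable_comp hfi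
  have h1 : ∫ x, (l x + 1) ∂μ = μ.real Set.univ := by
    rw [integral_add hl (integrable_const 1), l.integral_comp_comm hfi, hcent]
    simp
  calc μ Set.univ = ENNReal.ofReal (∫ x, (l x + 1) ∂μ) := by rw [h1]; simp
    _ ≤ ∫⁻ x, ENNReal.ofReal (l x + 1) ∂μ := by
      have h2 : Integrable (fun x => l x + 1) μ := hl.add (integrable_const 1)
      refine (ENNReal.ofReal_le_ofReal (integral_mono h2 h2.pos_part
        fun x => le_max_left _ _)).trans ?_
      rw [ofReal_integral_eq_lintegral_ofReal h2.pos_part (ae_of_all _ fun x => le_max_right _ _)]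
      simp
    _ ≤ _ := by gcongr; exact Real.add_one_le_exp _

theorem HasSantaloBound.prod {B : LinearMap.BilinForm ℝ E} (hB : ∀ x y, B x y = B y x) {c : ℝ≥0∞}
    (hE : HasSantaloBound E B c) :
    HasSantaloBound (ℝ × E) (prodPairing B) (ENNReal.ofReal (2 * Real.pi) * c) := by
  have hB' : ∀ p r, prodPairing B p r = prodPairing B r p := fun p r => by
    rw [prodPairing_apply, prodPairing_apply, hB, mul_comm]
  intro f g hf hg hfin hfi hcent H
  have main : ∀ g : ℝ × E → ℝ≥0∞, Measurable g → IsFiniteMeasure (volume.withDensity g) →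
      Integrable (fun p : ℝ × E => p) (volume.withDensity g) →
      (∀ x y, f x * g y ≤ ENNReal.ofReal (Real.exp (-prodPairing B x y))) →
      (∫⁻ x, f x) * ∫⁻ y, g y ≤ ENNReal.ofReal (2 * Real.pi) * c := by
    intro g hg hgfin hgint H
    obtain ⟨z, hz⟩ := hE.exists_translate hg hgfin hgint
    set l : ℝ × E →L[ℝ] ℝ := LinearMap.toContinuousLinearMap (prodPairing B z) with hl
    have hlz : ∀ r, l r = prodPairing B z r := fun r => rfl
    have hexp : Measurable fun r => ENNReal.ofReal (Real.exp (l r)) := by fun_prop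
    have h1 := hz (fun r => f r * ENNReal.ofReal (Real.exp (l r))) (by fun_prop) fun p r => by
      calc g (z + p) * (f r * ENNReal.ofReal (Real.exp (l r)))
          = f r * g (z + p) * ENNReal.ofReal (Real.exp (l r)) := by ring
        _ ≤ ENNReal.ofReal (Real.exp (-prodPairing B r (z + p))) *
            ENNReal.ofReal (Real.exp (l r)) := mul_le_mul' (H _ _) le_rfl
        _ = _ := by
          rw [← ENNReal.ofReal_mul (Real.exp_pos _).le, ← Real.exp_add, hlz, hB' r, map_add,
            LinearMap.add_apply]
          ring_nf
    have h2 := measure_univ_le_lintegral_exp hfi hcent l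
    rw [withDensity_apply _ MeasurableSet.univ, Measure.restrict_univ,
      lintegral_withDensity_eq_lintegral_mul _ hf hexp] at h2
    rw [mul_comm]
    exact (mul_le_mul' le_rfl h2).trans h1
  set G : ℕ → ℝ × E → ℝ≥0∞ := fun k => (Metric.closedBall 0 k).indicator fun y => min (g y) k
    with hG
  have hGm : ∀ k, Measurable (G k) := fun k =>
    (hg.min measurable_const).indicator measurableSet_closedBall
  have hGg : ∀ k y, G k y ≤ g y := fun k y =>
    (Set.indicator_le_self _ _ y).trans (min_le_left _ _)
  have hGmono : Monotone G := by
    intro k l hkl y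
    have h1 : Metric.closedBall (0 : ℝ × E) k ⊆ Metric.closedBall 0 l :=
      Metric.closedBall_subset_closedBall (by exact_mod_cast hkl)
    refine (Set.indicator_le_indicator_of_subset h1 (fun _ => zero_le) y).trans
      (Set.indicator_le_indicator (min_le_min_left _ ?_))
    exact_mod_cast hkl
  have hGsup : ∀ y, ⨆ k, G k y = g y := by
    intro y
    refine le_antisymm (iSup_le fun k => hGg k y) (le_of_forall_lt fun b hb => ?_)
    obtain ⟨k, hk⟩ := ENNReal.exists_nat_gt (ne_top_of_lt hb)
    obtain ⟨l, hl⟩ := exists_nat_ge ‖y‖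
    refine lt_iSup_iff.2 ⟨max k l, ?_⟩
    rw [hG]
    simp only
    rw [Set.indicator_of_mem]
    · exact lt_min hb (hk.trans_le (by exact_mod_cast le_max_left k l))
    · simpa using Or.inr hl
  have hGfin : ∀ k, ∫⁻ y, G k y < ∞ := by
    intro k
    calc ∫⁻ y, G k y ≤ ∫⁻ y in Metric.closedBall (0 : ℝ × E) k, k := by
          rw [← lintegral_indicator measurableSet_closedBall]
          gcongr with y
          exact Set.indicator_le_indicator (min_le_right _ _)
      _ < ∞ := by
          rw [setLIntegral_const]
          exact ENNReal.mul_lt_top (by simp) measure_closedBall_lt_top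
  calc (∫⁻ x, f x) * ∫⁻ y, g y = ⨆ k, (∫⁻ x, f x) * ∫⁻ y, G k y := by
        rw [← ENNReal.mul_iSup, ← lintegral_iSup hGm hGmono]
        simp only [hGsup]
    _ ≤ _ := iSup_le fun k => by
        have hfinG : IsFiniteMeasure (volume.withDensity (G k)) :=
          isFiniteMeasure_withDensity (hGfin k).ne
        refine main (G k) (hGm k) hfinG ?_ fun x y => (mul_le_mul' le_rfl (hGg k y)).trans (H x y)
        refine Integrable.of_bound (by fun_prop) k ?_
        rw [ae_withDensity_iff (hGm k)]
        refine ae_of_all _ fun y hy => ?_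
        have := Set.mem_of_indicator_ne_zero hy
        simpa using this
end

theorem HasSantaloBound.of_measurePreserving {E F : Type*} [NormedAddCommGroup E]
    [NormedSpace ℝ E] [MeasureSpace E] [BorelSpace E] [NormedAddCommGroup F] [NormedSpace ℝ F]
    [MeasureSpace F] [BorelSpace F] [FiniteDimensional ℝ E] [FiniteDimensional ℝ F]
    {B : LinearMap.BilinForm ℝ E} {c : ℝ≥0∞}
    (hE : HasSantaloBound E B c) (e : E ≃ₗ[ℝ] F) (he : MeasurePreserving e)
    {B' : LinearMap.BilinForm ℝ F} (hB : ∀ x y, B' (e x) (e y) = B x y) :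
    HasSantaloBound F B' c := by
  intro f g hf hg hfin hfi hcent H
  have hem : MeasurableEmbedding e :=
    e.toContinuousLinearEquiv.toHomeomorph.measurableEmbedding
  have hes : Measurable e.symm :=
    e.toContinuousLinearEquiv.symm.continuous.measurable
  have hmap : (volume.withDensity f) = (volume.withDensity fun x => f (e x)).map e := by
    ext A hA
    rw [Measure.map_apply he.measurable hA, withDensity_apply _ hA,
      withDensity_apply _ (he.measurable hA), he.setLIntegral_comp_preimage_emb hem]
  have hfi' : Integrable (fun x => e x) (volume.withDensity fun x => f (e x)) := by
    rw [hmap, integrable_map_measure (by fun_prop) he.measurable.aemeasurable] at hfi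
    exact hfi
  have hint2 : Integrable (fun x : E => x) (volume.withDensity fun x => f (e x)) := by
    simpa using e.toContinuousLinearEquiv.symm.toContinuousLinearMap.integrable_comp hfi'
  rw [← he.lintegral_comp_emb hem, ← he.lintegral_comp_emb hem]
  refine hE _ _ (hf.comp he.measurable) (hg.comp he.measurable) ?_ hint2 ?_
    fun x y => (H (e x) (e y)).trans (by rw [hB])
  · refine ⟨?_⟩
    have := measure_lt_top (volume.withDensity f) Set.univ
    rwa [hmap, Measure.map_apply he.measurable MeasurableSet.univ] at this
  · rw [hmap, integral_map he.measurable.aemeasurable (by fun_prop)] at hcent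
    have := e.toContinuousLinearEquiv.toContinuousLinearMap.integral_comp_comm hint2
    apply e.injective
    rw [map_zero, ← hcent]
    exact this.symm

theorem hasSantaloBound_pi (n : ℕ) :
    HasSantaloBound (Fin n → ℝ) (dotProductBilin ℝ ℝ) (ENNReal.ofReal (2 * Real.pi) ^ n) := by
  induction n with
  | zero =>
    intro f g hf hg _ _ _ H
    have := H 0 0
    simp only [volume_pi, Measure.pi_of_empty (x := (0 : Fin 0 → ℝ)), lintegral_dirac]
    simpa using this
  | succ n ih =>
    have h1 := ih.prod (fun x y => dotProduct_comm x y)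
    let e : (ℝ × (Fin n → ℝ)) ≃ₗ[ℝ] (Fin (n + 1) → ℝ) := Fin.consLinearEquiv ℝ (fun _ => ℝ)
    rw [pow_succ']
    refine h1.of_measurePreserving e ?_ ?_
    · have h2 := (volume_preserving_piFinSuccAbove (fun _ : Fin (n + 1) => ℝ) 0).symm
      have h3 : ⇑e = ⇑(MeasurableEquiv.piFinSuccAbove (fun _ : Fin (n + 1) => ℝ) 0).symm := by
        ext1 p
        exact (Fin.insertNth_zero' p.1 p.2).symm
      rwa [h3]
    · intro x y
      rw [prodPairing_apply]
      change ∑ i, e x i * e y i = x.1 * y.1 + ∑ i, x.2 i * y.2 i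
      rw [Fin.sum_univ_succ]
      rfl

theorem hasSantaloBound_euclideanSpace (n : ℕ) :
    HasSantaloBound (EuclideanSpace ℝ (Fin n)) (innerₗ _) (ENNReal.ofReal (2 * Real.pi) ^ n) := by
  refine (hasSantaloBound_pi n).of_measurePreserving (WithLp.linearEquiv 2 ℝ (Fin n → ℝ)).symm
    (PiLp.volume_preserving_toLp (Fin n)) fun x y => ?_
  simp [PiLp.inner_apply, dotProduct, mul_comm]

section Radial

variable {n : ℕ} {K : Set (EuclideanSpace ℝ (Fin n))}

/-- The average of the indicators of the dilates `r • K` with weight `r * exp (-r ^ 2 / 2)`. -/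
def radialProfile (K : Set (EuclideanSpace ℝ (Fin n))) (x : EuclideanSpace ℝ (Fin n)) : ℝ≥0∞ :=
  ∫⁻ r in Set.Ioi (0 : ℝ), ENNReal.ofReal (r * Real.exp (-(r ^ 2 / 2))) *
    K.indicator 1 (r⁻¹ • x)

/-- The measure `r ^ (n + 1) * exp (-r ^ 2 / 2) dr` on the positive half-line. -/
def radialMeasure (n : ℕ) : Measure ℝ :=
  (volume.restrict (Set.Ioi 0)).withDensity fun r =>
    ENNReal.ofReal (r ^ (n + 1) * Real.exp (-(r ^ 2 / 2)))

theorem measurable_uncurry_radialProfile_integrand (hK : MeasurableSet K) :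
    Measurable fun p : EuclideanSpace ℝ (Fin n) × ℝ =>
      ENNReal.ofReal (p.2 * Real.exp (-(p.2 ^ 2 / 2))) *
        K.indicator (1 : EuclideanSpace ℝ (Fin n) → ℝ≥0∞) (p.2⁻¹ • p.1) := by
  refine Measurable.mul (by fun_prop) ?_
  exact (measurable_one.indicator hK).comp (by fun_prop)

theorem measurable_radialProfile (hK : MeasurableSet K) : Measurable (radialProfile K) :=
  (measurable_uncurry_radialProfile_integrand hK).lintegral_prod_right'

theorem integrable_pow_mul_exp_neg_sq_div_two (k : ℕ) :
    Integrable fun r : ℝ => r ^ k * Real.exp (-(r ^ 2 / 2)) := by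
  have h := integrable_rpow_mul_exp_neg_mul_sq (b := 1 / 2) (by norm_num) (s := k)
    (by have : (0 : ℝ) ≤ k := Nat.cast_nonneg k
        linarith)
  convert! h using 4 with r
  · exact (Real.rpow_natCast r k).symm
  · ring

instance isFiniteMeasure_radialMeasure (n : ℕ) : IsFiniteMeasure (radialMeasure n) :=
  isFiniteMeasure_withDensity_ofReal
    (integrable_pow_mul_exp_neg_sq_div_two (n + 1)).integrableOn.2

theorem integrable_id_radialMeasure (n : ℕ) : Integrable (fun r : ℝ => r) (radialMeasure n) := by
  rw [radialMeasure, integrable_withDensity_iff (by fun_prop) (by simp)]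
  refine (integrable_pow_mul_exp_neg_sq_div_two (n + 2)).integrableOn.congr ?_
  filter_upwards [ae_restrict_mem measurableSet_Ioi] with r hr
  have hr' : 0 < r := hr
  rw [ENNReal.toReal_ofReal (by positivity)]
  ring

theorem withDensity_radialProfile (hK : MeasurableSet K) :
    volume.withDensity (radialProfile K) =
      Measure.map (fun p : ℝ × EuclideanSpace ℝ (Fin n) => p.1 • p.2)
        ((radialMeasure n).prod (volume.restrict K)) := by
  ext A hA
  have hm : Measurable fun p : ℝ × EuclideanSpace ℝ (Fin n) => p.1 • p.2 := by fun_prop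
  rw [withDensity_apply _ hA, Measure.map_apply hm hA, Measure.prod_apply (hm hA), radialMeasure,
    lintegral_withDensity_eq_lintegral_mul _ (by fun_prop) (measurable_measure_prodMk_left (hm hA))]
  unfold radialProfile
  rw [lintegral_lintegral_swap (measurable_uncurry_radialProfile_integrand hK).aemeasurable]
  refine setLIntegral_congr_fun measurableSet_Ioi fun r hr => ?_
  have hr' : 0 < r := hr
  have h1 (x : EuclideanSpace ℝ (Fin n)) :
      K.indicator (1 : EuclideanSpace ℝ (Fin n) → ℝ≥0∞) (r⁻¹ • x) = (r • K).indicator 1 x := by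
    by_cases hx : r⁻¹ • x ∈ K
    · rw [Set.indicator_of_mem hx,
        Set.indicator_of_mem ((Set.mem_smul_set_iff_inv_smul_mem₀ hr'.ne' K x).2 hx)]
      rfl
    · rw [Set.indicator_of_notMem hx,
        Set.indicator_of_notMem (mt (Set.mem_smul_set_iff_inv_smul_mem₀ hr'.ne' K x).1 hx)]
  have hrK : MeasurableSet (r • K) := hK.const_smul₀ r
  have h2 : r • K ∩ A = r • (Prod.mk r ⁻¹' ((fun p : ℝ × EuclideanSpace ℝ (Fin n) =>
      p.1 • p.2) ⁻¹' A) ∩ K) := by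
    ext x
    simp only [Set.mem_smul_set_iff_inv_smul_mem₀ hr'.ne', Set.mem_inter_iff, Set.mem_preimage,
      smul_inv_smul₀ hr'.ne']
    tauto
  simp only [h1, Pi.mul_apply]
  rw [lintegral_const_mul _ (measurable_one.indicator hrK), lintegral_indicator_one hrK,
    Measure.restrict_apply hrK, h2, Measure.addHaar_smul_of_nonneg _ hr'.le,
    finrank_euclideanSpace_fin, ← mul_assoc, ← ENNReal.ofReal_mul (by positivity),
    Measure.restrict_apply (measurable_prodMk_left (hm hA))]
  ring_nf

theorem lintegral_radialProfile (hK : MeasurableSet K) :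
    ∫⁻ x, radialProfile K x = radialMeasure n Set.univ * volume K := by
  have h := congrArg (fun μ => μ Set.univ) (withDensity_radialProfile hK)
  have hm : Measurable fun p : ℝ × EuclideanSpace ℝ (Fin n) => p.1 • p.2 := by fun_prop
  simp only [withDensity_apply _ MeasurableSet.univ, Measure.map_apply hm MeasurableSet.univ,
    Set.preimage_univ, Measure.restrict_univ] at h
  rw [h, ← Set.univ_prod_univ, Measure.prod_prod, Measure.restrict_apply_univ]

theorem isFiniteMeasure_withDensity_radialProfile (hK : IsCompact K) :
    IsFiniteMeasure (volume.withDensity (radialProfile K)) := by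
  refine isFiniteMeasure_withDensity ?_
  rw [lintegral_radialProfile hK.measurableSet]
  exact ENNReal.mul_ne_top (measure_ne_top _ _) hK.measure_ne_top

theorem integrable_id_withDensity_radialProfile (hK : IsCompact K) :
    Integrable (fun x : EuclideanSpace ℝ (Fin n) => x)
      (volume.withDensity (radialProfile K)) := by
  have hm : Measurable fun p : ℝ × EuclideanSpace ℝ (Fin n) => p.1 • p.2 := by fun_prop
  rw [withDensity_radialProfile hK.measurableSet,
    integrable_map_measure (by fun_prop) hm.aemeasurable]
  exact (integrable_id_radialMeasure n).smul_prod
    (continuous_id.continuousOn.integrableOn_compact hK)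

theorem integral_id_withDensity_radialProfile (hK : IsCompact K) :
    ∫ x, x ∂(volume.withDensity (radialProfile K)) =
      (∫ r, r ∂(radialMeasure n)) • ∫ x in K, x := by
  have hm : Measurable fun p : ℝ × EuclideanSpace ℝ (Fin n) => p.1 • p.2 := by fun_prop
  rw [withDensity_radialProfile hK.measurableSet,
    integral_map hm.aemeasurable (by fun_prop)]
  exact integral_prod_smul (fun r : ℝ => r) (fun x : EuclideanSpace ℝ (Fin n) => x)

theorem lintegral_Ioi_mul_exp_neg_sq_div_two {a : ℝ} (ha : 0 ≤ a) :
    ∫⁻ r in Set.Ioi a, ENNReal.ofReal (r * Real.exp (-(r ^ 2 / 2))) =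
      ENNReal.ofReal (Real.exp (-(a ^ 2 / 2))) := by
  have hfi : IntegrableOn (fun r : ℝ => r * Real.exp (-(r ^ 2 / 2))) (Set.Ioi a) := by
    simpa using (integrable_pow_mul_exp_neg_sq_div_two 1).integrableOn (s := Set.Ioi a)
  have hderiv (r : ℝ) : HasDerivAt (fun r : ℝ => -Real.exp (-(r ^ 2 / 2)))
      (r * Real.exp (-(r ^ 2 / 2))) r := by
    have h := ((((hasDerivAt_id r).pow 2).div_const 2).neg.exp).neg
    convert! h using 1
    simp
    ring
  have hlim : Tendsto (fun r : ℝ => -Real.exp (-(r ^ 2 / 2))) atTop (𝓝 0) := by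
    rw [← neg_zero]
    refine (Real.tendsto_exp_neg_atTop_nhds_zero.comp ?_).neg
    exact (tendsto_pow_atTop two_ne_zero).atTop_div_const two_pos
  rw [← ofReal_integral_eq_lintegral_ofReal hfi,
    integral_Ioi_of_hasDerivAt_of_tendsto' (fun r _ => hderiv r) hfi hlim]
  · simp
  · filter_upwards [ae_restrict_mem measurableSet_Ioi] with r hr
    have : 0 ≤ r := ha.trans (le_of_lt hr)
    positivity

theorem radialProfile_le {x : EuclideanSpace ℝ (Fin n)} {a : ℝ} (ha : 0 ≤ a)
    (h : ∀ r > (0 : ℝ), r⁻¹ • x ∈ K → a ≤ r) :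
    radialProfile K x ≤ ENNReal.ofReal (Real.exp (-(a ^ 2 / 2))) := by
  rw [← lintegral_Ioi_mul_exp_neg_sq_div_two ha, setLIntegral_congr Ioi_ae_eq_Ici,
    ← lintegral_indicator measurableSet_Ici, radialProfile,
    ← lintegral_indicator measurableSet_Ioi]
  refine lintegral_mono fun r => ?_
  by_cases hr : 0 < r
  · by_cases hK : r⁻¹ • x ∈ K
    · simp [hr, hK, h r hr hK]
    · simp [Set.indicator_of_notMem hK, Set.indicator_apply]
  · simp [hr]

theorem radialProfile_eq_zero {x : EuclideanSpace ℝ (Fin n)}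
    (h : ∀ r > (0 : ℝ), r⁻¹ • x ∉ K) : radialProfile K x = 0 := by
  refine setLIntegral_eq_zero measurableSet_Ioi fun r hr => ?_
  simp only [Set.indicator_of_notMem (h r hr), mul_zero, Pi.zero_apply]

theorem radialProfile_closedBall (x : EuclideanSpace ℝ (Fin n)) :
    radialProfile (Metric.closedBall 0 1) x = ENNReal.ofReal (Real.exp (-(‖x‖ ^ 2 / 2))) := by
  rw [← lintegral_Ioi_mul_exp_neg_sq_div_two (norm_nonneg x), setLIntegral_congr Ioi_ae_eq_Ici,
    ← lintegral_indicator measurableSet_Ici, radialProfile,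
    ← lintegral_indicator measurableSet_Ioi]
  refine lintegral_congr_ae ?_
  filter_upwards [Measure.ae_ne volume (0 : ℝ)] with r hr0
  rcases lt_or_gt_of_ne hr0 with hr | hr
  · simp [hr.not_gt, hr.trans_le (norm_nonneg x)]
  · have : r⁻¹ • x ∈ Metric.closedBall (0 : EuclideanSpace ℝ (Fin n)) 1 ↔ ‖x‖ ≤ r := by
      rw [mem_closedBall_zero_iff, norm_smul, norm_inv, Real.norm_of_nonneg hr.le,
        inv_mul_le_one₀ hr]
    by_cases hx : ‖x‖ ≤ r
    · simp only [Set.indicator, this, hx]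
      simp [hr, hx]
    · simp only [Set.indicator, this, hx]
      simp [hr, hx]

theorem radialProfile_mul_radialProfile_polarSet_le (x y : EuclideanSpace ℝ (Fin n)) :
    radialProfile K x * radialProfile (polarSet K) y ≤ ENNReal.ofReal (Real.exp (-⟪x, y⟫_ℝ)) := by
  by_cases hA : ∀ r > (0 : ℝ), r⁻¹ • x ∉ K
  · simp [radialProfile_eq_zero hA]
  by_cases hT : ∀ t > (0 : ℝ), t⁻¹ • y ∉ polarSet K
  · simp [radialProfile_eq_zero hT]
  push Not at hA hT
  set A : Set ℝ := {r | 0 < r ∧ r⁻¹ • x ∈ K} with hAdef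
  set T : Set ℝ := {t | 0 < t ∧ t⁻¹ • y ∈ polarSet K} with hTdef
  have hAne : A.Nonempty := hA
  have hTne : T.Nonempty := hT
  have hAb : BddBelow A := ⟨0, fun r hr => hr.1.le⟩
  have hTb : BddBelow T := ⟨0, fun r hr => hr.1.le⟩
  have ha : 0 ≤ sInf A := le_csInf hAne fun r hr => hr.1.le
  have hb : 0 ≤ sInf T := le_csInf hTne fun r hr => hr.1.le
  have hle : ∀ r ∈ A, ∀ t ∈ T, ⟪x, y⟫_ℝ ≤ r * t := by
    intro r hr t ht
    have h := ht.2 _ hr.2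
    rw [real_inner_smul_left, real_inner_smul_right, ← mul_assoc, ← mul_inv,
      inv_mul_le_one₀ (mul_pos hr.1 ht.1)] at h
    exact h
  have hle' : ⟪x, y⟫_ℝ ≤ sInf A * sInf T := by
    have h1 : ∀ r ∈ A, ⟪x, y⟫_ℝ ≤ r * sInf T := fun r hr => by
      rw [← div_le_iff₀' hr.1]
      exact le_csInf hTne fun t ht => (div_le_iff₀' hr.1).2 (hle r hr t ht)
    have h2 : Tendsto (fun r => r * sInf T) (𝓝[A] (sInf A)) (𝓝 (sInf A * sInf T)) :=
      (continuous_id.mul continuous_const).continuousWithinAt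
    have := mem_closure_iff_nhdsWithin_neBot.1 (csInf_mem_closure hAne hAb)
    exact ge_of_tendsto h2 (eventually_nhdsWithin_of_forall h1)
  calc radialProfile K x * radialProfile (polarSet K) y
      ≤ ENNReal.ofReal (Real.exp (-(sInf A ^ 2 / 2))) *
        ENNReal.ofReal (Real.exp (-(sInf T ^ 2 / 2))) :=
        mul_le_mul' (radialProfile_le ha fun r hr hx => csInf_le hAb ⟨hr, hx⟩)
          (radialProfile_le hb fun t ht hy => csInf_le hTb ⟨ht, hy⟩)
    _ ≤ ENNReal.ofReal (Real.exp (-⟪x, y⟫_ℝ)) := by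
        rw [← ENNReal.ofReal_mul (Real.exp_nonneg _), ← Real.exp_add]
        refine ENNReal.ofReal_le_ofReal (Real.exp_le_exp.2 ?_)
        nlinarith [sq_nonneg (sInf A - sInf T)]

theorem measurableSet_polarSet (K : Set (EuclideanSpace ℝ (Fin n))) :
    MeasurableSet (polarSet K) := by
  have : polarSet K = ⋂ x ∈ K, {y | ⟪x, y⟫_ℝ ≤ 1} := by
    ext y
    simp [polarSet]
  rw [this]
  exact (isClosed_biInter fun x _ => isClosed_le (by fun_prop) continuous_const).measurableSet

theorem sq_radialMeasure_univ_mul_volume_closedBall (n : ℕ) :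
    (radialMeasure n Set.univ *
      volume (Metric.closedBall (0 : EuclideanSpace ℝ (Fin n)) 1)) ^ 2 =
      ENNReal.ofReal (2 * Real.pi) ^ n := by
  have h := GaussianFourier.integral_rexp_neg_mul_sq_norm (V := EuclideanSpace ℝ (Fin n))
    (b := 1 / 2) (by norm_num)
  have hpos : 0 < ∫ v : EuclideanSpace ℝ (Fin n), Real.exp (-(1 / 2) * ‖v‖ ^ 2) := by
    rw [h]
    positivity
  have hfi : Integrable fun v : EuclideanSpace ℝ (Fin n) => Real.exp (-(1 / 2) * ‖v‖ ^ 2) :=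
    .of_integral_ne_zero hpos.ne'
  have h2 (v : EuclideanSpace ℝ (Fin n)) : -(‖v‖ ^ 2 / 2) = -(1 / 2) * ‖v‖ ^ 2 := by ring
  rw [← lintegral_radialProfile Metric.isClosed_closedBall.measurableSet]
  simp only [radialProfile_closedBall, h2]
  rw [← ofReal_integral_eq_lintegral_ofReal hfi (.of_forall fun v => Real.exp_nonneg _), h,
    finrank_euclideanSpace_fin, ← ENNReal.ofReal_pow (by positivity),
    ← ENNReal.ofReal_pow (by positivity), ← Real.rpow_natCast, ← Real.rpow_mul (by positivity),
    ← Real.rpow_natCast]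
  congr 2
  · ring
  · push_cast
    ring

end Radial

/-- Lutwak's inequality: if `K ⊆ ℝⁿ` is a compact star-shaped (about the origin) set with
`0` in its interior whose barycenter is at the origin, then
`vol(K)·vol(K*) ≤ vol(B₂ⁿ)²`. -/
theorem lutwak_starshaped (n : ℕ) (K : Set (EuclideanSpace ℝ (Fin n)))
    (hcomp : IsCompact K)
    (hstar : ∀ x ∈ K, ∀ t : ℝ, 0 ≤ t → t ≤ 1 → t • x ∈ K)
    (h0 : (0 : EuclideanSpace ℝ (Fin n)) ∈ interior K)
    (hbar : (∫ x in K, x ∂volume) = (0 : EuclideanSpace ℝ (Fin n))) :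
    volume K * volume (polarSet K) ≤
      (volume (Metric.closedBall (0 : EuclideanSpace ℝ (Fin n)) 1)) ^ 2 := by
  have hpolar := measurableSet_polarSet K
  have h := hasSantaloBound_euclideanSpace n (radialProfile K) (radialProfile (polarSet K))
    (measurable_radialProfile hcomp.measurableSet) (measurable_radialProfile hpolar)
    (isFiniteMeasure_withDensity_radialProfile hcomp)
    (integrable_id_withDensity_radialProfile hcomp)
    (by rw [integral_id_withDensity_radialProfile hcomp, hbar, smul_zero])
    radialProfile_mul_radialProfile_polarSet_le
  have hball := sq_radialMeasure_univ_mul_volume_closedBall n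
  have hne : radialMeasure n Set.univ ≠ 0 := by
    intro h'
    rw [h', zero_mul, zero_pow two_ne_zero] at hball
    exact pow_ne_zero n (ENNReal.ofReal_pos.2 Real.two_pi_pos).ne' hball.symm
  rw [lintegral_radialProfile hcomp.measurableSet, lintegral_radialProfile hpolar, ← hball,
    mul_mul_mul_comm, mul_pow, ← sq] at h
  rwa [ENNReal.mul_le_mul_iff_right (pow_ne_zero 2 hne) (by finiteness)] at h
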